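/- arXiv:1911.00557 — 7 statements merged into one kernel-verified Lean document; each statement's English description precedes it below -/
import Mathlib

section
/- Suppose the functions σ_1, …, σ_{K+1} : I → ℝ are differentiable and satisfy σ_k'(α) = −(k+1) σ_{k+1}(α) − x σ_1(α) σ_k(α) for all α ∈ I and all 1 ≤ k ≤ K. Then for all 2 ≤ n ≤ k ≤ K and all α ∈ I, the function Λ_{k,n}(σ) is differentiable with Λ_{k,n}(σ)'(α) = −(k+1) Λ_{k+1,n}(σ)(α) + n σ_1(α) Λ_{k,n−1}(σ)(α) − n x σ_1(α) Λ_{k,n}(σ)(α). -/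
/-- The array `Λ_{k,n}(a)` defined by `Λ_{n,n}(a) = a_1^n`, `Λ_{k,1}(a) = a_k`, and
`Λ_{k,n}(a) = Σ_{m=n-1}^{k-1} a_{k-m} Λ_{m,n-1}(a)` for `2 ≤ n < k`
(all operations taken pointwise when `a` consists of functions). -/
def Lam (a : ℕ → ℝ) : ℕ → ℕ → ℝ
  | _, 0 => 0
  | k, 1 => a k
  | k, n + 2 => ∑ m ∈ Finset.Ico (n + 1) k, a (k - m) * Lam a m (n + 1)

theorem Lam_succ_self (a : ℕ → ℝ) (n : ℕ) : Lam a (n + 1) (n + 1) = a 1 ^ (n + 1) := by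
  induction n with
  | zero => simp [Lam]
  | succ n ih => simp [Lam, ih, pow_succ']

theorem Lam_convolution_add_boundary (a : ℕ → ℝ) {n k : ℕ} (h : n < k) :
    a 1 * ∑ m ∈ Finset.Ico (n + 1) k, a (k - m) * Lam a m n
      + a (k - n) * Lam a (n + 1) (n + 1) = a 1 * Lam a k (n + 1) := by
  cases n with
  | zero => simp [Lam, mul_comm]
  | succ n =>
    rw [Lam_succ_self, Lam, Finset.sum_eq_sum_Ico_succ_bot h, Lam_succ_self]
    ring

theorem sum_Ico_weighted_add_shift (f : ℕ → ℝ) {p k : ℕ} (h : p ≤ k) :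
    ∑ m ∈ Finset.Ico p k, (((k : ℝ) - m + 1) * f m + ((m : ℝ) + 1) * f (m + 1))
      = ((k : ℝ) + 1) * ∑ m ∈ Finset.Ico p (k + 1), f m - f k - p * f p := by
  have telescope := Finset.sum_Ico_sub (fun m : ℕ => (m : ℝ) * f m) h
  rw [Finset.sum_Ico_succ_top h, mul_add, Finset.mul_sum]
  have split : ∑ m ∈ Finset.Ico p k, (((k : ℝ) - m + 1) * f m + ((m : ℝ) + 1) * f (m + 1))
      = ∑ m ∈ Finset.Ico p k, ((k : ℝ) + 1) * f m
        + ∑ m ∈ Finset.Ico p k, (((m + 1 : ℕ) : ℝ) * f (m + 1) - (m : ℝ) * f m) := by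
    rw [← Finset.sum_add_distrib]
    refine Finset.sum_congr rfl fun m _ => ?_
    push_cast
    ring
  rw [split, telescope]
  ring

theorem hasDerivAt_Lam_succ {x α : ℝ} {K : ℕ} {σ : ℕ → ℝ → ℝ}
    (hσ : ∀ k, 1 ≤ k → k ≤ K →
      HasDerivAt (σ k) (-((k : ℝ) + 1) * σ (k + 1) α - x * σ 1 α * σ k α) α)
    (n k : ℕ) (hnk : n < k) (hkK : k ≤ K) :
    HasDerivAt (fun β => Lam (fun j => σ j β) k (n + 1))
      (-((k : ℝ) + 1) * Lam (fun j => σ j α) (k + 1) (n + 1)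
        + ((n : ℝ) + 1) * σ 1 α * Lam (fun j => σ j α) k n
        - ((n : ℝ) + 1) * x * σ 1 α * Lam (fun j => σ j α) k (n + 1)) α := by
  induction n generalizing k with
  | zero => simpa [Lam] using hσ k hnk hkK
  | succ n ih =>
    set a : ℕ → ℝ := fun j => σ j α with ha
    have hsum := HasDerivAt.fun_sum (u := Finset.Ico (n + 1) k) fun m hm =>
      (hσ (k - m) (by grind) (by lia)).fun_mul (ih m (by grind) (by grind))
    simp only [Lam]
    refine hsum.congr_deriv ?_
    have boundary := Lam_convolution_add_boundary a (n := n) (k := k) (by lia)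
    have weighted := sum_Ico_weighted_add_shift
      (fun m => a (k + 1 - m) * Lam a m (n + 1)) (p := n + 1) (k := k) hnk.le
    simp only [Nat.add_sub_add_right, Nat.add_sub_cancel_left] at weighted
    push_cast at weighted ⊢
    trans -(∑ m ∈ Finset.Ico (n + 1) k,
          (((k : ℝ) - m + 1) * (a (k + 1 - m) * Lam a m (n + 1))
            + ((m : ℝ) + 1) * (a (k - m) * Lam a (m + 1) (n + 1))))
        + ((n : ℝ) + 1) * a 1 * ∑ m ∈ Finset.Ico (n + 1) k, a (k - m) * Lam a m n
        - ((n : ℝ) + 2) * x * a 1 * ∑ m ∈ Finset.Ico (n + 1) k, a (k - m) * Lam a m (n + 1)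
    · rw [Finset.mul_sum, Finset.mul_sum, ← Finset.sum_neg_distrib, ← Finset.sum_add_distrib,
        ← Finset.sum_sub_distrib]
      refine Finset.sum_congr rfl fun m hm => ?_
      have hmk : m < k := (Finset.mem_Ico.mp hm).2
      rw [show k + 1 - m = k - m + 1 by lia,
        Nat.cast_sub hmk.le]
      simp only [ha]
      ring
    · have hσ1 : σ 1 α = a 1 := rfl
      rw [weighted, hσ1]
      linear_combination ((n : ℝ) + 1) * boundary

/-- **Derivative of the `Λ` array along the RSB hierarchy of ODEs.**
If `σ_k' = -(k+1) σ_{k+1} - x σ_1 σ_k` on the open interval `I` for `1 ≤ k ≤ K`,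
then for all `2 ≤ n ≤ k ≤ K` and `α ∈ I`,
`Λ_{k,n}(σ)' (α) = -(k+1) Λ_{k+1,n}(σ)(α) + n σ_1(α) Λ_{k,n-1}(σ)(α)
  - n x σ_1(α) Λ_{k,n}(σ)(α)`. -/
theorem stmt1 (x : ℝ) (I : Set ℝ) (hIopen : IsOpen I)
    (hIinterval : I.OrdConnected)
    (K : ℕ) (hK : 2 ≤ K)
    (σ σ' : ℕ → ℝ → ℝ)
    (hdiff : ∀ k, 1 ≤ k → k ≤ K + 1 → ∀ α ∈ I, HasDerivAt (σ k) (σ' k α) α)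
    (hODE : ∀ k, 1 ≤ k → k ≤ K → ∀ α ∈ I,
      σ' k α = -((k : ℝ) + 1) * σ (k + 1) α - x * σ 1 α * σ k α)
    (k n : ℕ) (hn : 2 ≤ n) (hnk : n ≤ k) (hkK : k ≤ K)
    (α : ℝ) (hα : α ∈ I) :
    HasDerivAt (fun β => Lam (fun j => σ j β) k n)
      (-((k : ℝ) + 1) * Lam (fun j => σ j α) (k + 1) n
        + (n : ℝ) * σ 1 α * Lam (fun j => σ j α) k (n - 1)
        - (n : ℝ) * x * σ 1 α * Lam (fun j => σ j α) k n) α := by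
  obtain ⟨n, rfl⟩ : ∃ j, n = j + 1 := ⟨n - 1, by lia⟩
  have hσ : ∀ k, 1 ≤ k → k ≤ K →
      HasDerivAt (σ k) (-((k : ℝ) + 1) * σ (k + 1) α - x * σ 1 α * σ k α) α :=
    fun k hk hkK => hODE k hk hkK α hα ▸ hdiff k hk (by lia) α hα
  simpa using hasDerivAt_Lam_succ hσ n k hnk hkK
end

section
/- If |Z_1| ≤ Z_2 almost surely, then for every k ≥ 1 and every q ∈ [0,1], the recursively defined processes satisfy |Σ_k(Z_1; q)| ≤ Σ_k(Z_2; q) almost surely. -/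
open MeasureTheory

/-- The `k`-th coefficient of the integrand in the recursion for the processes `Σ_k`. -/
noncomputable def lamSeries (t : ℝ) (a : ℕ → ℝ) (k : ℕ) : ℝ :=
  ∑ n ∈ Finset.Icc 2 k, t ^ (n - 2) / ((n : ℝ) * ((n : ℝ) - 1)) * Lam a k n

lemma abs_Lam_le {a b : ℕ → ℝ} (n : ℕ) : ∀ k, 1 ≤ k →
    (∀ j, 1 ≤ j → j ≤ k → |a j| ≤ b j) → |Lam a k n| ≤ Lam b k n := by
  induction n with
  | zero => intro k _ _; simp [Lam]
  | succ n ih =>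
    intro k hk h
    cases n with
    | zero => simpa [Lam] using h k hk le_rfl
    | succ n =>
      simp only [Lam]
      refine (Finset.abs_sum_le_sum_abs _ _).trans (Finset.sum_le_sum fun m hm => ?_)
      rw [Finset.mem_Ico] at hm
      rw [abs_mul]
      have h₁ := h (k - m) (by omega) (by omega)
      exact mul_le_mul h₁ (ih m (by omega) fun j hj hjm => h j hj (by omega))
        (abs_nonneg _) ((abs_nonneg _).trans h₁)

lemma abs_Lam_le_of_two_le {a b : ℕ → ℝ} {n k : ℕ} (hn : 2 ≤ n)
    (h : ∀ j, 1 ≤ j → j < k → |a j| ≤ b j) : |Lam a k n| ≤ Lam b k n := by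
  obtain ⟨n, rfl⟩ := Nat.exists_eq_add_of_le' hn
  simp only [Lam]
  refine (Finset.abs_sum_le_sum_abs _ _).trans (Finset.sum_le_sum fun m hm => ?_)
  rw [Finset.mem_Ico] at hm
  rw [abs_mul]
  have h₁ := h (k - m) (by omega) (by omega)
  exact mul_le_mul h₁ (abs_Lam_le _ m (by omega) fun j hj hjm => h j hj (by omega))
    (abs_nonneg _) ((abs_nonneg _).trans h₁)

lemma natCast_mul_sub_one_nonneg {n : ℕ} (hn : 2 ≤ n) : 0 ≤ (n : ℝ) * ((n : ℝ) - 1) := by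
  have : (2 : ℝ) ≤ n := by exact_mod_cast hn
  exact mul_nonneg (by linarith) (by linarith)

lemma abs_lamSeries_le {t : ℝ} (ht : 0 ≤ t) {a b : ℕ → ℝ} {k : ℕ}
    (h : ∀ j, 1 ≤ j → j < k → |a j| ≤ b j) : |lamSeries t a k| ≤ lamSeries t b k := by
  refine (Finset.abs_sum_le_sum_abs _ _).trans (Finset.sum_le_sum fun n hn => ?_)
  rw [Finset.mem_Icc] at hn
  have hw : 0 ≤ t ^ (n - 2) / ((n : ℝ) * ((n : ℝ) - 1)) :=
    div_nonneg (pow_nonneg ht _) (natCast_mul_sub_one_nonneg hn.1)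
  rw [abs_mul, abs_of_nonneg hw]
  exact mul_le_mul_of_nonneg_left (abs_Lam_le_of_two_le hn.1 h) hw

lemma lamSeries_le_lamSeries_one {t : ℝ} (ht : 0 ≤ t) (ht1 : t ≤ 1) {b : ℕ → ℝ} {k : ℕ}
    (h : ∀ j, 1 ≤ j → j < k → 0 ≤ b j) : lamSeries t b k ≤ lamSeries 1 b k := by
  refine Finset.sum_le_sum fun n hn => ?_
  rw [Finset.mem_Icc] at hn
  have hb : 0 ≤ Lam b k n :=
    (abs_nonneg _).trans (abs_Lam_le_of_two_le (a := b) hn.1 fun j hj hjk =>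
      (abs_of_nonneg (h j hj hjk)).le)
  refine mul_le_mul_of_nonneg_right (div_le_div_of_nonneg_right ?_
    (natCast_mul_sub_one_nonneg hn.1)) hb
  rw [one_pow]
  exact pow_le_one₀ ht ht1

lemma measurable_Lam {α : Type*} [MeasurableSpace α] {f : ℕ → α → ℝ}
    (hf : ∀ j, Measurable (f j)) (n : ℕ) :
    ∀ k, Measurable fun p => Lam (fun j => f j p) k n := by
  induction n with
  | zero => intro k; simp [Lam]
  | succ n ih =>
    intro k
    cases n with
    | zero => simpa [Lam] using hf k
    | succ n =>
      simp only [Lam]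
      exact Finset.measurable_fun_sum _ fun m _ => (hf (k - m)).mul (ih m)

lemma aemeasurable_lamSeries {α : Type*} [MeasurableSpace α] {ρ : Measure α} {g : α → ℝ}
    {f : ℕ → α → ℝ} (hg : AEMeasurable g ρ) (hf : ∀ j, Measurable (f j)) (k : ℕ) :
    AEMeasurable (fun p => lamSeries (g p) (fun j => f j p) k) ρ :=
  Finset.aemeasurable_fun_sum _ fun n _ =>
    ((hg.pow_const (n - 2)).div_const _).mul (measurable_Lam hf n k).aemeasurable

lemma abs_condExp_le_condExp {Ω : Type*} {m mΩ : MeasurableSpace Ω} {μ : Measure Ω}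
    {f g : Ω → ℝ} (hf : Integrable f μ) (hg : Integrable g μ) (h : ∀ᵐ ω ∂μ, |f ω| ≤ g ω) :
    ∀ᵐ ω ∂μ, |μ[f | m] ω| ≤ μ[g | m] ω := by
  filter_upwards [abs_condExp_ae_le_condExp_abs (μ := μ) (m := m) f,
    condExp_mono (m := m) hf.abs hg h] with ω h₁ h₂
  exact le_trans h₁ h₂

lemma condExp_le_of_le_const {Ω : Type*} {m mΩ : MeasurableSpace Ω} {μ : Measure Ω}
    [IsFiniteMeasure μ] (hm : m ≤ mΩ) {g : Ω → ℝ} {C : ℝ} (hg : Integrable g μ)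
    (h : ∀ᵐ ω ∂μ, g ω ≤ C) : ∀ᵐ ω ∂μ, μ[g | m] ω ≤ C := by
  filter_upwards [condExp_mono (m := m) hg (integrable_const C) h] with ω hω
  simpa [condExp_const hm] using hω

/-- Integrating the recursion integrand against a finite measure preserves domination,
integrability and boundedness. -/
lemma integral_lamSeries_domination {Ω : Type*} {mΩ : MeasurableSpace Ω} {μ : Measure Ω}
    [IsFiniteMeasure μ] {ρ : Measure ℝ} [IsFiniteMeasure ρ] {x : ℝ → ℝ}
    (hx : AEMeasurable x ρ) (hx01 : ∀ᵐ q ∂ρ, 0 ≤ x q ∧ x q ≤ 1) {S₁ S₂ : ℕ → ℝ → Ω → ℝ}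
    (hS₁ : ∀ k, Measurable (fun p : ℝ × Ω => S₁ k p.1 p.2))
    (hS₂ : ∀ k, Measurable (fun p : ℝ × Ω => S₂ k p.1 p.2)) {C : ℕ → ℝ} {k : ℕ}
    (hdom : ∀ j, 1 ≤ j → j < k → ∀ᵐ q ∂ρ, ∀ᵐ ω ∂μ, |S₁ j q ω| ≤ S₂ j q ω ∧ S₂ j q ω ≤ C j) :
    Integrable (fun ω => ∫ q, lamSeries (x q) (fun j => S₁ j q ω) k ∂ρ) μ ∧
    Integrable (fun ω => ∫ q, lamSeries (x q) (fun j => S₂ j q ω) k ∂ρ) μ ∧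
    (∀ᵐ ω ∂μ, |∫ q, lamSeries (x q) (fun j => S₁ j q ω) k ∂ρ| ≤
      ∫ q, lamSeries (x q) (fun j => S₂ j q ω) k ∂ρ) ∧
    (∀ᵐ ω ∂μ, ∫ q, lamSeries (x q) (fun j => S₂ j q ω) k ∂ρ ≤
      lamSeries 1 C k * ρ.real Set.univ) := by
  have hmeas : ∀ S : ℕ → ℝ → Ω → ℝ, (∀ k, Measurable (fun p : ℝ × Ω => S k p.1 p.2)) →
      AEStronglyMeasurable (fun ω => ∫ q, lamSeries (x q) (fun j => S j q ω) k ∂ρ) μ ∧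
      ∀ ω, AEStronglyMeasurable (fun q => lamSeries (x q) (fun j => S j q ω) k) ρ := by
    intro S hS
    constructor
    · have : AEStronglyMeasurable
          (fun z : Ω × ℝ => lamSeries (x z.2) (fun j => S j z.2 z.1) k) (μ.prod ρ) :=
        (aemeasurable_lamSeries (f := fun j (z : Ω × ℝ) => S j z.2 z.1)
          hx.comp_snd (fun j => (hS j).comp measurable_swap) k).aestronglyMeasurable
      exact this.integral_prod_right'
    · intro ω
      exact (aemeasurable_lamSeries (f := fun j q => S j q ω)
        hx (fun j => (hS j).comp measurable_prodMk_right) k).aestronglyMeasurable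
  have hae : ∀ᵐ ω ∂μ, ∀ᵐ q ∂ρ, ∀ j, 1 ≤ j → j < k →
      |S₁ j q ω| ≤ S₂ j q ω ∧ S₂ j q ω ≤ C j := by
    have : ∀ j, 1 ≤ j → j < k → ∀ᵐ ω ∂μ, ∀ᵐ q ∂ρ, |S₁ j q ω| ≤ S₂ j q ω ∧ S₂ j q ω ≤ C j := by
      intro j hj hjk
      refine (Measure.ae_ae_comm ?_).1 (hdom j hj hjk)
      exact (measurableSet_le (hS₁ j).abs (hS₂ j)).inter
        (measurableSet_le (hS₂ j) measurable_const)
    have h' : ∀ᵐ ω ∂μ, ∀ j, 1 ≤ j → j < k →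
        ∀ᵐ q ∂ρ, |S₁ j q ω| ≤ S₂ j q ω ∧ S₂ j q ω ≤ C j := by
      simpa only [ae_all_iff] using this
    filter_upwards [h'] with ω hω
    simpa only [ae_all_iff] using hω
  have hpt : ∀ᵐ ω ∂μ, ∀ᵐ q ∂ρ,
      |lamSeries (x q) (fun j => S₁ j q ω) k| ≤ lamSeries (x q) (fun j => S₂ j q ω) k ∧
      |lamSeries (x q) (fun j => S₂ j q ω) k| ≤ lamSeries 1 C k := by
    filter_upwards [hae] with ω hω
    filter_upwards [hω, hx01] with q hq hxq
    have hnn : ∀ j, 1 ≤ j → j < k → 0 ≤ S₂ j q ω :=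
      fun j hj hjk => (abs_nonneg _).trans (hq j hj hjk).1
    refine ⟨abs_lamSeries_le hxq.1 fun j hj hjk => (hq j hj hjk).1,
      (abs_lamSeries_le (b := C) hxq.1 fun j hj hjk => ?_).trans
        (lamSeries_le_lamSeries_one hxq.1 hxq.2 fun j hj hjk =>
          (hnn j hj hjk).trans (hq j hj hjk).2)⟩
    rw [abs_of_nonneg (hnn j hj hjk)]
    exact (hq j hj hjk).2
  have hb₂ : ∀ᵐ ω ∂μ, |∫ q, lamSeries (x q) (fun j => S₂ j q ω) k ∂ρ| ≤
      lamSeries 1 C k * ρ.real Set.univ := by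
    filter_upwards [hpt] with ω hω
    exact norm_integral_le_of_norm_le_const
      (f := fun q => lamSeries (x q) (fun j => S₂ j q ω) k) (hω.mono fun q hq => hq.2)
  have hd : ∀ᵐ ω ∂μ, |∫ q, lamSeries (x q) (fun j => S₁ j q ω) k ∂ρ| ≤
      ∫ q, lamSeries (x q) (fun j => S₂ j q ω) k ∂ρ := by
    filter_upwards [hpt] with ω hω
    exact norm_integral_le_of_norm_le
      (f := fun q => lamSeries (x q) (fun j => S₁ j q ω) k)
      (Integrable.of_bound ((hmeas S₂ hS₂).2 ω) _ (hω.mono fun q hq => hq.2))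
      (hω.mono fun q hq => hq.1)
  refine ⟨Integrable.of_bound (hmeas S₁ hS₁).1 (lamSeries 1 C k * ρ.real Set.univ) ?_,
    Integrable.of_bound (hmeas S₂ hS₂).1 _ hb₂, hd, hb₂.mono fun ω hω => (le_abs_self _).trans hω⟩
  filter_upwards [hd, hb₂] with ω h₁ h₂
  exact h₁.trans ((le_abs_self _).trans h₂)

/-- **Domination of the series-expansion coefficient processes.**
If `|Z₁| ≤ Z₂` a.s., then for every `k ≥ 1` and `q ∈ [0,1]`,
`|Σ_k(Z₁; q)| ≤ Σ_k(Z₂; q)` a.s., where the `Σ_k(Z; ·)` satisfy the recursion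
`Σ_1(Z; q) = E[Z | F_q]` and, for `k ≥ 2`,
`Σ_k(Z; q) = E[∫_{(q,1]} Σ_{n=2}^{k} (x(q')^{n-2}/(n(n-1))) Λ_{k,n}(Σ(Z); q') dμ(q') | F_q]`,
`μ` being the Lebesgue–Stieltjes measure of the Parisi order parameter `x`. -/
theorem stmt2
    {Ω : Type*} {mΩ : MeasurableSpace Ω} (μ : Measure Ω) [IsProbabilityMeasure μ]
    (ℱ : Filtration ℝ mΩ)
    (x : ℝ → ℝ)
    (hxmono : MonotoneOn x (Set.Icc (0 : ℝ) 1))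
    (hxcont : ContinuousOn x (Set.Icc (0 : ℝ) 1))
    (hx0 : x 0 = 0) (hx1 : x 1 = 1)
    (ν : Measure ℝ)
    (hν : ∀ a b : ℝ, 0 ≤ a → a ≤ b → b ≤ 1 →
      ν (Set.Ioc a b) = ENNReal.ofReal (x b - x a))
    (Z₁ Z₂ : Ω → ℝ)
    (hZ₁meas : StronglyMeasurable[ℱ 1] Z₁) (hZ₂meas : StronglyMeasurable[ℱ 1] Z₂)
    (C₁ C₂ : ℝ) (hZ₁bdd : ∀ᵐ ω ∂μ, |Z₁ ω| ≤ C₁) (hZ₂bdd : ∀ᵐ ω ∂μ, |Z₂ ω| ≤ C₂)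
    (Sig₁ Sig₂ : ℕ → ℝ → Ω → ℝ)
    (hSig₁jm : ∀ k, Measurable (fun p : ℝ × Ω => Sig₁ k p.1 p.2))
    (hSig₂jm : ∀ k, Measurable (fun p : ℝ × Ω => Sig₂ k p.1 p.2))
    (hSig₁bdd : ∀ k, 1 ≤ k → ∀ q ∈ Set.Icc (0 : ℝ) 1, ∃ C : ℝ, ∀ᵐ ω ∂μ, |Sig₁ k q ω| ≤ C)
    (hSig₂bdd : ∀ k, 1 ≤ k → ∀ q ∈ Set.Icc (0 : ℝ) 1, ∃ C : ℝ, ∀ᵐ ω ∂μ, |Sig₂ k q ω| ≤ C)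
    (hSig₁one : ∀ q ∈ Set.Icc (0 : ℝ) 1, Sig₁ 1 q =ᵐ[μ] μ[Z₁ | ℱ q])
    (hSig₂one : ∀ q ∈ Set.Icc (0 : ℝ) 1, Sig₂ 1 q =ᵐ[μ] μ[Z₂ | ℱ q])
    (hSig₁rec : ∀ k, 2 ≤ k → ∀ q ∈ Set.Icc (0 : ℝ) 1,
      Sig₁ k q =ᵐ[μ] μ[(fun ω => ∫ q' in Set.Ioc q 1,
        (∑ n ∈ Finset.Icc 2 k,
          x q' ^ (n - 2) / ((n : ℝ) * ((n : ℝ) - 1)) *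
            Lam (fun j => Sig₁ j q' ω) k n) ∂ν) | ℱ q])
    (hSig₂rec : ∀ k, 2 ≤ k → ∀ q ∈ Set.Icc (0 : ℝ) 1,
      Sig₂ k q =ᵐ[μ] μ[(fun ω => ∫ q' in Set.Ioc q 1,
        (∑ n ∈ Finset.Icc 2 k,
          x q' ^ (n - 2) / ((n : ℝ) * ((n : ℝ) - 1)) *
            Lam (fun j => Sig₂ j q' ω) k n) ∂ν) | ℱ q])
    (hdom : ∀ᵐ ω ∂μ, |Z₁ ω| ≤ Z₂ ω) :
    ∀ k, 1 ≤ k → ∀ q ∈ Set.Icc (0 : ℝ) 1,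
      ∀ᵐ ω ∂μ, |Sig₁ k q ω| ≤ Sig₂ k q ω := by
  have key : ∀ k, 1 ≤ k → ∃ C : ℝ, ∀ q ∈ Set.Icc (0 : ℝ) 1,
      ∀ᵐ ω ∂μ, |Sig₁ k q ω| ≤ Sig₂ k q ω ∧ Sig₂ k q ω ≤ C := by
    intro k
    induction k using Nat.strong_induction_on with
    | _ k ih =>
      intro hk
      obtain rfl | hk2 : k = 1 ∨ 2 ≤ k := by omega
      · have hi₁ : Integrable Z₁ μ :=
          Integrable.of_bound (hZ₁meas.mono (ℱ.le 1)).aestronglyMeasurable C₁ hZ₁bdd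
        have hi₂ : Integrable Z₂ μ :=
          Integrable.of_bound (hZ₂meas.mono (ℱ.le 1)).aestronglyMeasurable C₂ hZ₂bdd
        refine ⟨C₂, fun q hq => ?_⟩
        filter_upwards [hSig₁one q hq, hSig₂one q hq,
          abs_condExp_le_condExp (m := ℱ q) hi₁ hi₂ hdom,
          condExp_le_of_le_const (ℱ.le q) hi₂
            (hZ₂bdd.mono fun ω hω => (le_abs_self _).trans hω)] with ω h₁ h₂ h₃ h₄
        rw [h₁, h₂]
        exact ⟨h₃, h₄⟩
      · choose! C hC using ih
        refine ⟨max (lamSeries 1 C k) 0, fun q hq => ?_⟩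
        have hsub : Set.Ioc q 1 ⊆ Set.Icc (0 : ℝ) 1 := fun y hy => ⟨hq.1.trans hy.1.le, hy.2⟩
        have h0 : (0 : ℝ) ∈ Set.Icc (0 : ℝ) 1 := by simp
        have h1 : (1 : ℝ) ∈ Set.Icc (0 : ℝ) 1 := by simp
        have hxr : ∀ y ∈ Set.Icc (0 : ℝ) 1, 0 ≤ x y ∧ x y ≤ 1 := fun y hy =>
          ⟨hx0 ▸ hxmono h0 hy hy.1, hx1 ▸ hxmono hy h1 hy.2⟩
        have hνq := hν q 1 hq.1 hq.2 le_rfl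
        have : IsFiniteMeasure (ν.restrict (Set.Ioc q 1)) :=
          ⟨by rw [Measure.restrict_apply_univ, hνq]; exact ENNReal.ofReal_lt_top⟩
        have hmass0 : 0 ≤ (ν.restrict (Set.Ioc q 1)).real Set.univ := measureReal_nonneg
        have hmass : (ν.restrict (Set.Ioc q 1)).real Set.univ ≤ 1 := by
          rw [measureReal_def, Measure.restrict_apply_univ, hνq, hx1]
          refine ENNReal.toReal_le_of_le_ofReal zero_le_one (ENNReal.ofReal_le_ofReal ?_)
          linarith [(hxr q hq).1]
        obtain ⟨hi₁, hi₂, hd, hb⟩ := integral_lamSeries_domination (μ := μ)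
          (ρ := ν.restrict (Set.Ioc q 1))
          (aemeasurable_restrict_of_monotoneOn measurableSet_Ioc (hxmono.mono hsub))
          ((ae_restrict_mem measurableSet_Ioc).mono fun y hy => hxr y (hsub hy))
          hSig₁jm hSig₂jm (C := C) (k := k) (fun j hj hjk =>
            (ae_restrict_mem measurableSet_Ioc).mono fun y hy => hC j hjk hj y (hsub hy))
        filter_upwards [hSig₁rec k hk2 q hq, hSig₂rec k hk2 q hq,
          abs_condExp_le_condExp (m := ℱ q) hi₁ hi₂ hd,
          condExp_le_of_le_const (ℱ.le q) hi₂ hb] with ω h₁ h₂ h₃ h₄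
        rw [h₁, h₂]
        refine ⟨h₃, h₄.trans ?_⟩
        calc _ ≤ max (lamSeries 1 C k) 0 * (ν.restrict (Set.Ioc q 1)).real Set.univ :=
              mul_le_mul_of_nonneg_right (le_max_left _ _) hmass0
          _ ≤ _ := mul_le_of_le_one_right (le_max_right _ _) hmass
  intro k hk q hq
  obtain ⟨C, hC⟩ := key k hk
  exact (hC q hq).mono fun ω hω => hω.1
end

section
/- The backward-iterated free-energy variables form a supermartingale with respect to the given filtration: for every 0 ≤ n ≤ K, each φ_n is 𝒢_n-measurable and E[φ_{n+1} | 𝒢_n] ≤ φ_n almost surely. -/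
open MeasureTheory

section LogCondExp

variable {Ω : Type*} {m F : MeasurableSpace Ω} {μ : Measure Ω} [IsFiniteMeasure μ]
  {X : Ω → ℝ} {a c : ℝ}

lemma integrable_exp_mul_of_ae_abs_le (ha : 0 ≤ a) (hX : Measurable X)
    (hc : ∀ᵐ ω ∂μ, |X ω| ≤ c) : Integrable (fun ω => Real.exp (a * X ω)) μ := by
  refine Integrable.of_bound (by fun_prop) (Real.exp (a * c)) ?_
  filter_upwards [hc] with ω hω
  rw [Real.norm_eq_abs, Real.abs_exp]
  gcongr
  exact (abs_le.1 hω).2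

lemma condExp_exp_mul_mem_Icc (hm : m ≤ F) (ha : 0 ≤ a) (hX : Measurable X)
    (hc : ∀ᵐ ω ∂μ, |X ω| ≤ c) :
    ∀ᵐ ω ∂μ, (μ[fun ω' => Real.exp (a * X ω') | m]) ω ∈
      Set.Icc (Real.exp (a * -c)) (Real.exp (a * c)) := by
  refine (convex_Icc _ _).condExp_mem hm (integrable_exp_mul_of_ae_abs_le ha hX hc) isClosed_Icc ?_
  filter_upwards [hc] with ω hω
  obtain ⟨h1, h2⟩ := abs_le.1 hω
  constructor <;> gcongr

lemma abs_log_condExp_exp_mul_le (hm : m ≤ F) (ha : 0 < a) (hX : Measurable X)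
    (hc : ∀ᵐ ω ∂μ, |X ω| ≤ c) :
    ∀ᵐ ω ∂μ, |(1 / a) * Real.log ((μ[fun ω' => Real.exp (a * X ω') | m]) ω)| ≤ c := by
  filter_upwards [condExp_exp_mul_mem_Icc hm ha.le hX hc] with ω ⟨h1, h2⟩
  have hpos := (Real.exp_pos _).trans_le h1
  rw [← Real.le_log_iff_exp_le hpos] at h1
  rw [← Real.log_le_iff_le_exp hpos] at h2
  rw [one_div, inv_mul_eq_div, abs_le, le_div_iff₀ ha, div_le_iff₀ ha]
  constructor <;> linarith

lemma condExp_le_log_condExp_exp_mul (hm : m ≤ F) (ha : 0 < a) (hX : Measurable X)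
    (hc : ∀ᵐ ω ∂μ, |X ω| ≤ c) :
    ∀ᵐ ω ∂μ, (μ[X | m]) ω ≤
      (1 / a) * Real.log ((μ[fun ω' => Real.exp (a * X ω') | m]) ω) := by
  have hcvx : ConvexOn ℝ Set.univ fun t : ℝ => Real.exp (a * t) := by
    exact convexOn_exp.comp_linearMap (LinearMap.mul ℝ ℝ a)
  have hcont : Continuous fun t : ℝ => Real.exp (a * t) := by fun_prop
  have hjensen := hcvx.map_condExp_le_univ (f := X) hm hcont.lowerSemicontinuous
    (Integrable.of_bound hX.aestronglyMeasurable c hc)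
    (integrable_exp_mul_of_ae_abs_le ha.le hX hc)
  filter_upwards [hjensen] with ω hω
  have hω' : Real.exp (a * (μ[X | m]) ω) ≤ (μ[fun ω' => Real.exp (a * X ω') | m]) ω := hω
  rw [← Real.le_log_iff_exp_le ((Real.exp_pos _).trans_le hω')] at hω'
  rw [one_div, inv_mul_eq_div, le_div_iff₀ ha]
  linarith

end LogCondExp

/-- **The backward-iterated free-energy variables form a supermartingale**:
for every `0 ≤ n ≤ K`, `φ_n` is `𝒢_n`-measurable and `E[φ_{n+1} | 𝒢_n] ≤ φ_n` a.s. -/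
theorem stmt7
    {Ω : Type*} {F : MeasurableSpace Ω} (μ : Measure Ω) [IsProbabilityMeasure μ]
    (K : ℕ) (𝒢 : ℕ → MeasurableSpace Ω)
    (h𝒢mono : ∀ m n : ℕ, m ≤ n → 𝒢 m ≤ 𝒢 n)
    (h𝒢le : ∀ n : ℕ, 𝒢 n ≤ F)
    (x : ℕ → ℝ)
    (hx1 : 0 < x 1)
    (hxmono : ∀ m n : ℕ, 1 ≤ m → m ≤ n → n ≤ K + 1 → x m ≤ x n)
    (hxtop : x (K + 1) = 1)
    (c : ℝ)
    (Ψ : Ω → ℝ) (hΨmeas : Measurable[𝒢 (K + 1)] Ψ)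
    (hΨbdd : ∀ᵐ ω ∂μ, |Ψ ω| ≤ c)
    (φ : ℕ → Ω → ℝ)
    (hφtop : φ (K + 1) = Ψ)
    (hφrec : ∀ n ≤ K, φ n = fun ω =>
      (1 / x (n + 1)) *
        Real.log ((μ[fun ω' => Real.exp (x (n + 1) * φ (n + 1) ω') | 𝒢 n]) ω)) :
    ∀ n ≤ K, Measurable[𝒢 n] (φ n) ∧
      ∀ᵐ ω ∂μ, (μ[φ (n + 1) | 𝒢 n]) ω ≤ φ n ω := by
  have hxpos : ∀ n ≤ K, 0 < x (n + 1) := fun n hn =>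
    hx1.trans_le (hxmono 1 (n + 1) le_rfl (by omega) (by omega))
  have hmeas : ∀ n ≤ K, Measurable[𝒢 n] (φ n) := by
    intro n hn
    rw [hφrec n hn]
    exact (Real.measurable_log.comp stronglyMeasurable_condExp.measurable).const_mul _
  have hmeasF : ∀ n ≤ K + 1, Measurable (φ n) := by
    intro n hn
    rcases hn.eq_or_lt with rfl | hn
    · exact hφtop ▸ hΨmeas.mono (h𝒢le _) le_rfl
    · exact (hmeas n (by omega)).mono (h𝒢le _) le_rfl
  have hbdd : ∀ n ≤ K + 1, ∀ᵐ ω ∂μ, |φ n ω| ≤ c := by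
    intro n hn
    induction hn using Nat.decreasingInduction with
    | self => exact hφtop ▸ hΨbdd
    | of_succ n hn ih =>
      rw [hφrec n (by omega)]
      exact abs_log_condExp_exp_mul_le (h𝒢le n) (hxpos n (by omega)) (hmeasF _ hn) ih
  intro n hn
  refine ⟨hmeas n hn, ?_⟩
  rw [hφrec n hn]
  exact condExp_le_log_condExp_exp_mul (h𝒢le n) (hxpos n hn) (hmeasF _ (by omega))
    (hbdd _ (by omega))
end

section
/- Let (Ω, F, P) be a probability space and φ a bounded F-measurable random variable. For x > 0 define F(x) = (1/x) log E[e^{xφ}] and let P_x be the tilted probability measure with density e^{xφ} / E[e^{xφ}] with respect to P. Then F is differentiable on (0, ∞) and F'(x) = D_KL(P_x ‖ P) / x² ≥ 0, where D_KL denotes the Kullback–Leibler divergence; in particular F is nondecreasing on (0, ∞). -/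
open MeasureTheory ProbabilityTheory

lemma llr_tilted_self_ae_eq {Ω : Type*} [MeasurableSpace Ω] {μ : Measure Ω} [SigmaFinite μ]
    {f : Ω → ℝ} (hf : Integrable (fun ω ↦ Real.exp (f ω)) μ) :
    llr (μ.tilted f) μ =ᵐ[μ.tilted f] fun ω ↦ f ω - Real.log (∫ ω, Real.exp (f ω) ∂μ) :=
  (tilted_absolutelyContinuous μ f).ae_le (log_rnDeriv_tilted_left_self hf)

lemma integrable_llr_tilted_mul {Ω : Type*} [MeasurableSpace Ω] {μ : Measure Ω}
    [IsProbabilityMeasure μ] {X : Ω → ℝ} {t : ℝ} (ht : t ∈ interior (integrableExpSet X μ)) :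
    Integrable (llr (μ.tilted (t * X ·)) μ) (μ.tilted (t * X ·)) := by
  have hexp : Integrable (fun ω ↦ Real.exp (t * X ω)) μ :=
    interior_subset (s := integrableExpSet X μ) ht
  have := isProbabilityMeasure_tilted hexp
  rw [integrable_congr (llr_tilted_self_ae_eq hexp)]
  exact (((memLp_tilted_mul ht 1).integrable le_rfl).const_mul t).sub (integrable_const _)

/-- The relative entropy of an exponentially tilted measure, in terms of the cumulant generating
function. -/
lemma integral_llr_tilted_mul {Ω : Type*} [MeasurableSpace Ω] {μ : Measure Ω}
    [IsProbabilityMeasure μ] {X : Ω → ℝ} {t : ℝ} (ht : t ∈ interior (integrableExpSet X μ)) :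
    ∫ ω, llr (μ.tilted (t * X ·)) μ ω ∂(μ.tilted (t * X ·)) =
      t * deriv (cgf X μ) t - cgf X μ t := by
  have hexp : Integrable (fun ω ↦ Real.exp (t * X ω)) μ :=
    interior_subset (s := integrableExpSet X μ) ht
  have := isProbabilityMeasure_tilted hexp
  rw [integral_congr_ae (llr_tilted_self_ae_eq hexp),
    integral_sub (((memLp_tilted_mul ht 1).integrable le_rfl).const_mul t) (integrable_const _),
    integral_const_mul, integral_tilted_mul_self ht]
  simp [cgf, mgf]

lemma integral_llr_tilted_mul_nonneg {Ω : Type*} [MeasurableSpace Ω] {μ : Measure Ω}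
    [IsProbabilityMeasure μ] {X : Ω → ℝ} {t : ℝ} (ht : t ∈ interior (integrableExpSet X μ)) :
    0 ≤ ∫ ω, llr (μ.tilted (t * X ·)) μ ω ∂(μ.tilted (t * X ·)) := by
  have hexp : Integrable (fun ω ↦ Real.exp (t * X ω)) μ :=
    interior_subset (s := integrableExpSet X μ) ht
  have := isProbabilityMeasure_tilted hexp
  simpa using InformationTheory.integral_llr_add_sub_measure_univ_nonneg
    (tilted_absolutelyContinuous μ _) (integrable_llr_tilted_mul ht)

lemma hasDerivAt_inv_mul_cgf {Ω : Type*} [MeasurableSpace Ω] {μ : Measure Ω}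
    [IsProbabilityMeasure μ] {X : Ω → ℝ} {t : ℝ} (ht : t ∈ interior (integrableExpSet X μ))
    (ht0 : t ≠ 0) :
    HasDerivAt (fun s ↦ 1 / s * cgf X μ s)
      ((∫ ω, llr (μ.tilted (t * X ·)) μ ω ∂(μ.tilted (t * X ·))) / t ^ 2) t := by
  have h := (analyticAt_cgf ht).differentiableAt.hasDerivAt.div (hasDerivAt_id t) ht0
  rw [integral_llr_tilted_mul ht]
  refine (h.congr_deriv ?_).congr_of_eventuallyEq (.of_forall fun s ↦ ?_)
  · simp [mul_comm]
  · simp [div_eq_inv_mul]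

/-- **Derivative of the one-level RSB free energy in the Parisi parameter.**
For bounded measurable `φ`, `F(x) = (1/x) log E[e^{xφ}]` is differentiable on `(0,∞)` with
`F'(x) = D_KL(P_x ‖ P) / x² ≥ 0`, where `P_x` is the tilted measure with density
`e^{xφ} / E[e^{xφ}]` w.r.t. `P`; in particular `F` is nondecreasing on `(0,∞)`. -/
theorem stmt9
    {Ω : Type*} [MeasurableSpace Ω] (μ : Measure Ω) [IsProbabilityMeasure μ]
    (φ : Ω → ℝ) (hφm : Measurable φ)
    (c : ℝ) (hφb : ∀ᵐ ω ∂μ, |φ ω| ≤ c)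
    (F : ℝ → ℝ)
    (hF : ∀ x : ℝ, F x = (1 / x) * Real.log (∫ ω, Real.exp (x * φ ω) ∂μ))
    (Px : ℝ → Measure Ω)
    (hPx : ∀ x : ℝ, Px x = μ.withDensity
      (fun ω => ENNReal.ofReal (Real.exp (x * φ ω) / ∫ ω', Real.exp (x * φ ω') ∂μ)))
    (D : ℝ → ℝ)
    -- `D x` is the Kullback–Leibler divergence `D_KL(P_x ‖ P) = ∫ log (dP_x/dP) dP_x`
    (hD : ∀ x : ℝ, D x = ∫ ω, Real.log (((Px x).rnDeriv μ) ω).toReal ∂(Px x)) :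
    (∀ x : ℝ, 0 < x → HasDerivAt F (D x / x ^ 2) x ∧ 0 ≤ D x / x ^ 2) ∧
      MonotoneOn F (Set.Ioi 0) := by
  have hint (x : ℝ) : x ∈ interior (integrableExpSet φ μ) := by
    have huniv : integrableExpSet φ μ = Set.univ := Set.eq_univ_of_forall fun t ↦
      integrable_exp_mul_of_mem_Icc hφm.aemeasurable (hφb.mono fun ω hω ↦ abs_le.mp hω)
    simp [huniv]
  have hF' : F = fun s ↦ 1 / s * cgf φ μ s := funext hF
  have hD' (x : ℝ) : D x = ∫ ω, llr (μ.tilted (x * φ ·)) μ ω ∂(μ.tilted (x * φ ·)) := by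
    rw [hD, hPx]
    rfl
  have hderiv (x : ℝ) (hx : 0 < x) : HasDerivAt F (D x / x ^ 2) x := by
    rw [hF', hD']
    exact hasDerivAt_inv_mul_cgf (hint x) hx.ne'
  have hnonneg (x : ℝ) : 0 ≤ D x / x ^ 2 := by
    rw [hD']
    exact div_nonneg (integral_llr_tilted_mul_nonneg (hint x)) (sq_nonneg x)
  refine ⟨fun x hx ↦ ⟨hderiv x hx, hnonneg x⟩, ?_⟩
  refine monotoneOn_of_hasDerivWithinAt_nonneg (f' := fun x ↦ D x / x ^ 2) (convex_Ioi 0)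
    (fun x hx ↦ (hderiv x hx).continuousAt.continuousWithinAt) (fun x hx ↦ ?_)
    fun x _ ↦ hnonneg x
  rw [interior_Ioi] at hx
  exact (hderiv x hx).hasDerivWithinAt
end

section
/- For every β > 0, every integer k ≥ 1, reals J_1, …, J_k and h_1, …, h_k, and s ∈ {−1, 1}, setting u_i = u(J_i, h_i): Π_{i=1}^{k} [ Σ_{σ ∈ {−1,1}} exp(βJ_i σ s)(1 + σ·tanh(βh_i)) ] = [ Π_{i=1}^{k} ( 2·cosh(βJ_i) / cosh(β u_i) ) ] · cosh(β Σ_{i=1}^{k} u_i) · (1 + s·tanh(β Σ_{i=1}^{k} u_i)). -/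
/-- The inverse hyperbolic tangent, `artanh t = (1/2) log((1+t)/(1-t))`. -/
noncomputable def artanh (t : ℝ) : ℝ := (1 / 2) * Real.log ((1 + t) / (1 - t))

/-- The cavity function `u(J,h) = (1/β) artanh(tanh(βJ) tanh(βh))`. -/
noncomputable def cavityU (β J h : ℝ) : ℝ :=
  (1 / β) * artanh (Real.tanh (β * J) * Real.tanh (β * h))

theorem tanh_mul_tanh_mem_Ioo (x y : ℝ) : Real.tanh x * Real.tanh y ∈ Set.Ioo (-1 : ℝ) 1 := by
  rw [Set.mem_Ioo, ← abs_lt, abs_mul]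
  exact mul_lt_one_of_nonneg_of_lt_one_left (abs_nonneg _) (Real.abs_tanh_lt_one x)
    (Real.abs_tanh_lt_one y).le

theorem tanh_mul_cavityU {β : ℝ} (hβ : β ≠ 0) (J h : ℝ) :
    Real.tanh (β * cavityU β J h) = Real.tanh (β * J) * Real.tanh (β * h) := by
  have hmem := tanh_mul_tanh_mem_Ioo (β * J) (β * h)
  rw [cavityU, ← mul_assoc, mul_one_div_cancel hβ, one_mul, artanh,
    ← Real.artanh_eq_half_log (Set.Ioo_subset_Icc_self hmem), Real.tanh_artanh hmem]

theorem cosh_mul_one_add_mul_tanh {s : ℝ} (hs : s = -1 ∨ s = 1) (x : ℝ) :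
    Real.cosh x * (1 + s * Real.tanh x) = Real.exp (s * x) := by
  have hc : Real.cosh x ≠ 0 := (Real.cosh_pos x).ne'
  rw [Real.tanh_eq_sinh_div_cosh]
  field_simp
  rcases hs with rfl | rfl
  · rw [neg_one_mul, neg_one_mul, ← Real.cosh_sub_sinh, sub_eq_add_neg]
  · rw [one_mul, one_mul, Real.cosh_add_sinh]

theorem sum_exp_mul_one_add_mul {s : ℝ} (hs : s = -1 ∨ s = 1) (x t : ℝ) :
    ∑ σ ∈ ({-1, 1} : Finset ℝ), Real.exp (x * σ * s) * (1 + σ * t)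
      = 2 * Real.cosh x * (1 + s * (Real.tanh x * t)) := by
  have hc : Real.cosh x ≠ 0 := (Real.cosh_pos x).ne'
  rw [Finset.sum_pair (by norm_num), Real.tanh_eq_sinh_div_cosh]
  field_simp
  rw [Real.cosh_eq, Real.sinh_eq]
  rcases hs with rfl | rfl <;> simp <;> ring

/-- **Cavity merging identity.** For `β > 0`, `k ≥ 1`, couplings `J_1, …, J_k`,
fields `h_1, …, h_k` and `s ∈ {-1,1}`, with `u_i = u(J_i, h_i)`:
`Π_i [Σ_{σ∈{-1,1}} exp(βJ_iσs)(1 + σ tanh(βh_i))]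
  = [Π_i (2 cosh(βJ_i)/cosh(βu_i))] · cosh(β Σ_i u_i) · (1 + s tanh(β Σ_i u_i))`. -/
theorem stmt12 (β : ℝ) (hβ : 0 < β) (k : ℕ) (hk : 1 ≤ k)
    (J h : ℕ → ℝ) (s : ℝ) (hs : s = -1 ∨ s = 1) :
    (∏ i ∈ Finset.range k,
        ∑ σ ∈ ({-1, 1} : Finset ℝ), Real.exp (β * J i * σ * s) * (1 + σ * Real.tanh (β * h i)))
      = (∏ i ∈ Finset.range k,
            (2 * Real.cosh (β * J i) / Real.cosh (β * cavityU β (J i) (h i))))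
        * Real.cosh (β * ∑ i ∈ Finset.range k, cavityU β (J i) (h i))
        * (1 + s * Real.tanh (β * ∑ i ∈ Finset.range k, cavityU β (J i) (h i))) := by
  rw [mul_assoc, cosh_mul_one_add_mul_tanh hs, Finset.mul_sum, Finset.mul_sum, Real.exp_sum,
    ← Finset.prod_mul_distrib]
  refine Finset.prod_congr rfl fun i _ => ?_
  rw [sum_exp_mul_one_add_mul hs, ← tanh_mul_cavityU hβ.ne', ← cosh_mul_one_add_mul_tanh hs,
    ← mul_assoc, div_mul_cancel₀ _ (Real.cosh_pos _).ne']
end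

section
/- For every β > 0, every integer k ≥ 1, and reals J_1, …, J_k and h_1, …, h_k, setting u_i = u(J_i, h_i), the following partition-function identity holds exactly: Σ_{s ∈ {−1,1}} Π_{i=1}^{k} [ Σ_{σ ∈ {−1,1}} exp(βJ_i σ s)(1 + σ·tanh(βh_i)) ] = 2·cosh(β Σ_{i=1}^{k} u_i) · Π_{i=1}^{k} ( 2·cosh(βJ_i) / cosh(β u_i) ). -/
theorem tanh_artanh_of_abs_lt_one {t : ℝ} (ht : |t| < 1) : Real.tanh (artanh t) = t := by
  have hmem : t ∈ Set.Ioo (-1 : ℝ) 1 := abs_lt.mp ht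
  have heq : artanh t = Real.artanh t :=
    (Real.artanh_eq_half_log (Set.Ioo_subset_Icc_self hmem)).symm
  rw [heq, Real.tanh_artanh hmem]

/-- The sum over `σ = ±1` of the spin weights is proportional to `exp y` when
`tanh y = tanh a * t`. -/
theorem sum_spin_weight {a t y : ℝ} (hy : Real.tanh y = Real.tanh a * t) :
    Real.exp (-a) * (1 - t) + Real.exp a * (1 + t)
      = 2 * Real.cosh a / Real.cosh y * Real.exp y := by
  have ha := (Real.cosh_pos a).ne'
  have hc := (Real.cosh_pos y).ne'
  rw [Real.tanh_eq_sinh_div_cosh, Real.tanh_eq_sinh_div_cosh] at hy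
  field_simp at hy
  rw [← Real.cosh_add_sinh a, ← Real.cosh_sub_sinh a, ← Real.cosh_add_sinh y]
  field_simp
  linear_combination -2 * hy

/-- **Partition function of a cavity iteration.** For `β > 0`, `k ≥ 1`, couplings
`J_1, …, J_k` and fields `h_1, …, h_k`, with `u_i = u(J_i, h_i)`:
`Σ_{s∈{-1,1}} Π_i [Σ_{σ∈{-1,1}} exp(βJ_iσs)(1 + σ tanh(βh_i))]
  = 2 cosh(β Σ_i u_i) · Π_i (2 cosh(βJ_i)/cosh(βu_i))`. -/
theorem stmt13 (β : ℝ) (hβ : 0 < β) (k : ℕ) (hk : 1 ≤ k) (J h : ℕ → ℝ) :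
    (∑ s ∈ ({-1, 1} : Finset ℝ),
        ∏ i ∈ Finset.range k,
          ∑ σ ∈ ({-1, 1} : Finset ℝ),
            Real.exp (β * J i * σ * s) * (1 + σ * Real.tanh (β * h i)))
      = 2 * Real.cosh (β * ∑ i ∈ Finset.range k, cavityU β (J i) (h i))
        * ∏ i ∈ Finset.range k,
            (2 * Real.cosh (β * J i) / Real.cosh (β * cavityU β (J i) (h i))) := by
  have hu (i : ℕ) := tanh_mul_cavityU hβ.ne' (J i) (h i)
  have hplus (i : ℕ) := sum_spin_weight (hu i)
  have hminus (i : ℕ) : Real.exp (β * J i) * (1 - Real.tanh (β * h i))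
        + Real.exp (-(β * J i)) * (1 + Real.tanh (β * h i))
      = 2 * Real.cosh (β * J i) / Real.cosh (β * cavityU β (J i) (h i))
        * Real.exp (-(β * cavityU β (J i) (h i))) := by
    have := sum_spin_weight (a := -(β * J i)) (t := Real.tanh (β * h i))
      (y := -(β * cavityU β (J i) (h i)))
      (by rw [Real.tanh_neg, Real.tanh_neg, hu, neg_mul])
    simpa only [neg_neg, Real.cosh_neg] using this
  have hne : (-1 : ℝ) ≠ 1 := by norm_num
  simp only [Finset.sum_pair hne, mul_neg, mul_one, neg_neg, neg_mul, one_mul, ← sub_eq_add_neg,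
    hplus, hminus, Finset.prod_mul_distrib, ← Real.exp_sum, Finset.sum_neg_distrib,
    ← Finset.mul_sum]
  rw [Real.cosh_eq]
  ring
end

section
/- For every β > 0 and reals J, h: |u(J,h)| ≤ min(|J|, |h|), where u(J,h) = (1/β)·artanh(tanh(βJ)·tanh(βh)). -/
theorem artanh_eq_real_artanh {t : ℝ} (ht : t ∈ Set.Icc (-1) 1) :
    artanh t = Real.artanh t :=
  (Real.artanh_eq_half_log ht).symm

theorem abs_artanh_le_of_abs_le_abs_tanh {t x : ℝ} (h : |t| ≤ |Real.tanh x|) :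
    |artanh t| ≤ |x| := by
  wlog hx : 0 ≤ x generalizing x
  · rw [← abs_neg x]
    exact this (by rwa [Real.tanh_neg, abs_neg]) (by linarith)
  have hx_lt := Real.tanh_lt_one x
  have hx_nonneg : 0 ≤ Real.tanh x := by
    rw [Real.tanh_eq_sinh_div_cosh]
    exact div_nonneg (Real.sinh_nonneg_iff.2 hx) (Real.cosh_pos x).le
  rw [abs_of_nonneg hx_nonneg] at h
  obtain ⟨hl, hr⟩ := abs_le.1 h
  rw [artanh_eq_real_artanh ⟨by linarith, by linarith⟩, abs_of_nonneg hx, abs_le]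
  constructor
  · have := Real.artanh_le_artanh (x := Real.tanh (-x)) (y := t)
      (Real.neg_one_lt_tanh _) (by linarith) (by rwa [Real.tanh_neg])
    rwa [Real.artanh_tanh] at this
  · have := Real.artanh_le_artanh (by linarith) hx_lt hr
    rwa [Real.artanh_tanh] at this

/-- **Bound on the effective cavity field.** For every `β > 0` and reals `J, h`:
`|u(J,h)| ≤ min(|J|, |h|)`. -/
theorem stmt17 (β J h : ℝ) (hβ : 0 < β) :
    |cavityU β J h| ≤ min |J| |h| := by
  have key (s x : ℝ) : |artanh (Real.tanh s * Real.tanh x)| ≤ |x| := by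
    apply abs_artanh_le_of_abs_le_abs_tanh
    rw [abs_mul]
    exact mul_le_of_le_one_left (abs_nonneg _)
      (abs_le.2 ⟨(Real.neg_one_lt_tanh s).le, (Real.tanh_lt_one s).le⟩)
  have hu : |cavityU β J h| = |artanh (Real.tanh (β * J) * Real.tanh (β * h))| / β := by
    rw [cavityU, abs_mul, abs_of_pos (one_div_pos.2 hβ), one_div_mul_eq_div]
  have habs (x : ℝ) : |β * x| = |x| * β := by rw [abs_mul, abs_of_pos hβ, mul_comm]
  rw [hu, le_min_iff, div_le_iff₀ hβ, div_le_iff₀ hβ, ← habs, ← habs]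
  exact ⟨mul_comm (Real.tanh (β * J)) _ ▸ key (β * h) (β * J), key (β * J) (β * h)⟩
end
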